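/- arXiv:1305.6653 — 3 statements merged into one kernel-verified Lean document; each statement's English description precedes it below -/
import Mathlib

section
/- Let N ≥ 2 be an integer, let d̄_+, d̄_- ≥ 0 with d̄_+ + d̄_- ≠ 0, let Δx > 0, and set s(J_N) = (1/Δx^α)(d̄_+ · s(G_α) + d̄_- · s(G_α^T)). Then every (complex) eigenvalue of s(J_N) has strictly negative real part. -/
open Matrix

/-- The alternating fractional binomial coefficient
`g_k^(α) = (-1)^k (α choose k) = ((-1)^k / k!) · α(α-1)⋯(α-k+1)`. -/
noncomputable def g (α : ℝ) (k : ℕ) : ℝ :=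
  (-1 : ℝ) ^ k * (∏ i ∈ Finset.range k, (α - i)) / (Nat.factorial k)

/-- First column of the Strang-type circulant approximation `s(G_α)`:
`c_0 = g_1^(α)`, `c_r = g_{r+1}^(α)` for `1 ≤ r ≤ ⌊(N+1)/2⌋ - 1`,
`c_{N-1} = g_0^(α)`, and `c_r = 0` otherwise. -/
noncomputable def sGcol (α : ℝ) (N : ℕ) : Fin N → ℝ := fun r =>
  if (r : ℕ) = 0 then g α 1
  else if (r : ℕ) = N - 1 then g α 0
  else if (r : ℕ) ≤ (N + 1) / 2 - 1 then g α ((r : ℕ) + 1)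
  else 0

/-- The Strang-type circulant matrix `s(G_α)`, with `(s(G_α))_{i,j} = c_{(i-j) mod N}`. -/
noncomputable def sG (α : ℝ) (N : ℕ) : Matrix (Fin N) (Fin N) ℝ :=
  Matrix.circulant (sGcol α N)

theorem g_succ (α : ℝ) (k : ℕ) : g α (k + 1) = g α k * ((k - α) / (k + 1)) := by
  have h : (k.factorial : ℝ) ≠ 0 := by positivity
  have h' : (k : ℝ) + 1 ≠ 0 := by positivity
  simp only [g, Finset.prod_range_succ, Nat.factorial_succ, pow_succ]
  push_cast
  field_simp
  ring

theorem g_succ_eq_g_sub_one (α : ℝ) (k : ℕ) : g α (k + 1) = -α / (k + 1) * g (α - 1) k := by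
  have h : (k.factorial : ℝ) ≠ 0 := by positivity
  have h' : (k : ℝ) + 1 ≠ 0 := by positivity
  have hp : ∏ i ∈ Finset.range k, (α - ((i + 1 : ℕ) : ℝ)) =
      ∏ i ∈ Finset.range k, (α - 1 - i) :=
    Finset.prod_congr rfl fun i _ => by push_cast; ring
  simp only [g, Finset.prod_range_succ', hp, Nat.factorial_succ, pow_succ]
  push_cast
  field_simp
  ring

theorem sum_range_g (α : ℝ) (m : ℕ) : ∑ k ∈ Finset.range (m + 1), g α k = g (α - 1) m := by
  induction m with
  | zero => simp [g]
  | succ m ih =>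
    have h' : (m : ℝ) + 1 ≠ 0 := by positivity
    rw [Finset.sum_range_succ, ih, g_succ_eq_g_sub_one, g_succ (α - 1)]
    field_simp
    ring

theorem g_succ_neg {β : ℝ} (h0 : 0 < β) (h1 : β < 1) (k : ℕ) : g β (k + 1) < 0 := by
  induction k with
  | zero => simpa [g] using h0
  | succ k ih =>
    rw [g_succ]
    refine mul_neg_of_neg_of_pos ih (div_pos ?_ (by positivity))
    have : (0 : ℝ) ≤ k := k.cast_nonneg
    push_cast
    linarith

theorem g_add_two_pos {α : ℝ} (h1 : 1 < α) (h2 : α < 2) (k : ℕ) : 0 < g α (k + 2) := by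
  rw [g_succ_eq_g_sub_one]
  refine mul_pos_of_neg_of_neg (div_neg_of_neg_of_pos (by linarith) (by positivity)) ?_
  exact g_succ_neg (by linarith) (by linarith) k

theorem sGcol_nonneg {α : ℝ} (h1 : 1 < α) (h2 : α < 2) {N : ℕ} {r : Fin N} (hr : (r : ℕ) ≠ 0) :
    0 ≤ sGcol α N r := by
  obtain ⟨k, hk⟩ := Nat.exists_eq_succ_of_ne_zero hr
  rw [sGcol, if_neg hr]
  split_ifs
  · simp [g]
  · rw [hk]
    exact (g_add_two_pos h1 h2 k).le
  · exact le_rfl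

theorem sum_sGcol_neg {α : ℝ} (h1 : 1 < α) (h2 : α < 2) (M : ℕ) :
    ∑ r, sGcol α (M + 2) r < 0 := by
  have hle : ∀ r : Fin M, sGcol α (M + 2) r.castSucc.succ ≤ g α (r + 2) := by
    intro r
    have := (g_add_two_pos h1 h2 r).le
    have hr := r.isLt
    have hval : (r.castSucc.succ : ℕ) = r + 1 := by simp
    rw [sGcol, if_neg (by omega), if_neg (by omega)]
    split_ifs
    · rw [hval]
    · exact this
  have hsum := sum_range_g α (M + 1)
  rw [Finset.sum_range_succ', Finset.sum_range_succ',
    ← Fin.sum_univ_eq_sum_range (fun k => g α (k + 1 + 1))] at hsum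
  have hneg := g_succ_neg (β := α - 1) (by linarith) (by linarith) M
  have hfirst : sGcol α (M + 2) 0 = g α (0 + 1) := by simp [sGcol]
  have hlast : sGcol α (M + 2) (Fin.last M).succ = g α 0 := by simp [sGcol]
  rw [Fin.sum_univ_succ, Fin.sum_univ_castSucc, hfirst, hlast]
  have := Finset.sum_le_sum fun r (_ : r ∈ Finset.univ) => hle r
  linarith

/-- A real matrix with nonnegative off-diagonal entries and negative row sums has its spectrum
in the open left half-plane. -/
theorem re_neg_of_mem_spectrum_of_row_sum_neg {n : Type*} [Fintype n] [DecidableEq n]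
    {A : Matrix n n ℝ} (hA : ∀ i j, i ≠ j → 0 ≤ A i j) (hsum : ∀ i, ∑ j, A i j < 0)
    {z : ℂ} (hz : z ∈ spectrum ℂ (A.map Complex.ofReal)) : z.re < 0 := by
  rw [← Matrix.spectrum_toLin', ← Module.End.hasEigenvalue_iff_mem_spectrum] at hz
  obtain ⟨i, hi⟩ := eigenvalue_mem_ball hz
  have hnorm : ∑ j ∈ Finset.univ.erase i, ‖A.map Complex.ofReal i j‖ =
      ∑ j ∈ Finset.univ.erase i, A i j :=
    Finset.sum_congr rfl fun j hj => by
      simp [abs_of_nonneg (hA i j (Finset.ne_of_mem_erase hj).symm)]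
  rw [mem_closedBall_iff_norm, hnorm] at hi
  have hre := (Complex.re_le_norm _).trans hi
  have := hsum i
  rw [← Finset.add_sum_erase _ _ (Finset.mem_univ i)] at this
  simp only [Complex.sub_re, Matrix.map_apply, Complex.ofReal_re] at hre
  linarith

/-- Let `d̄₊, d̄₋ ≥ 0` with `d̄₊ + d̄₋ ≠ 0`, `Δx > 0`, and
`s(J_N) = (1/Δx^α)(d̄₊ s(G_α) + d̄₋ s(G_α)ᵀ)`.  Then every (complex)
eigenvalue of `s(J_N)` has strictly negative real part. -/
theorem stmt11 (α : ℝ) (hα1 : 1 < α) (hα2 : α < 2) (N : ℕ) (hN : 2 ≤ N)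
    (dbp dbm : ℝ) (hdbp : 0 ≤ dbp) (hdbm : 0 ≤ dbm) (hdb : dbp + dbm ≠ 0)
    (Δx : ℝ) (hΔx : 0 < Δx)
    (sJ : Matrix (Fin N) (Fin N) ℝ)
    (hsJ : sJ = (Δx ^ α)⁻¹ • (dbp • sG α N + dbm • (sG α N)ᵀ)) :
    ∀ z ∈ spectrum ℂ (sJ.map Complex.ofReal), z.re < 0 := by
  subst hsJ
  obtain ⟨M, rfl⟩ := Nat.exists_eq_add_of_le' hN
  intro z hz
  have hK : 0 < (Δx ^ α)⁻¹ := inv_pos.mpr (Real.rpow_pos_of_pos hΔx α)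
  have hd : 0 < dbp + dbm := lt_of_le_of_ne (add_nonneg hdbp hdbm) hdb.symm
  have hoff : ∀ i j : Fin (M + 2), i ≠ j → 0 ≤ sGcol α (M + 2) (i - j) := fun i j hij =>
    sGcol_nonneg hα1 hα2 (Fin.val_ne_zero_iff.mpr (sub_ne_zero.mpr hij))
  refine re_neg_of_mem_spectrum_of_row_sum_neg (fun i j hij => ?_) (fun i => ?_) hz
  · have := hoff i j hij
    have := hoff j i hij.symm
    simp only [sG, Matrix.smul_apply, Matrix.add_apply, Matrix.transpose_apply,
      Matrix.circulant_apply, smul_eq_mul]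
    positivity
  · have hrow : ∑ j, sGcol α (M + 2) (i - j) = ∑ r, sGcol α (M + 2) r :=
      (Equiv.subLeft i).sum_comp (sGcol α (M + 2))
    have hcol : ∑ j, sGcol α (M + 2) (j - i) = ∑ r, sGcol α (M + 2) r :=
      (Equiv.subRight i).sum_comp (sGcol α (M + 2))
    simp only [sG, Matrix.smul_apply, Matrix.add_apply, Matrix.transpose_apply,
      Matrix.circulant_apply, smul_eq_mul, ← Finset.mul_sum, Finset.sum_add_distrib, hrow, hcol,
      ← add_mul]
    exact mul_neg_of_pos_of_neg hK (mul_neg_of_pos_of_neg hd (sum_sGcol_neg hα1 hα2 M))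
end

section
/- (Theorem 3.4) Let d_+, d_- ≥ 0 with d_+ + d_- ≠ 0 and Δx > 0, and let t_k (k ∈ ℤ) be the diagonals of the constant-coefficient Toeplitz matrix T_N = (1/Δx^α)(d_+ G_α + d_- G_α^T), namely t_{-1} = (d_+ g_0^(α) + d_- g_2^(α))/Δx^α, t_0 = (d_+ + d_-) g_1^(α)/Δx^α, t_1 = (d_+ g_2^(α) + d_- g_0^(α))/Δx^α, t_k = d_+ g_{k+1}^(α)/Δx^α for k ≥ 2, t_k = d_- g_{-k+1}^(α)/Δx^α for k ≤ -2. Then the generating function p(θ) = ∑_{k=-∞}^∞ t_k e^{ikθ} is in the Wiener class; more precisely, ∑_{k=-∞}^{∞} |t_k| = 2α (d_+ + d_-)/Δx^α < ∞. -/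
lemma g_zero (α : ℝ) : g α 0 = 1 := by simp [g]

lemma g_one (α : ℝ) : g α 1 = -α := by simp [g]

lemma succ_mul_g_succ (α : ℝ) (k : ℕ) : ((k : ℝ) + 1) * g α (k + 1) = (k - α) * g α k := by
  have h1 : (k.factorial : ℝ) ≠ 0 := by positivity
  have h2 : (k : ℝ) + 1 ≠ 0 := by positivity
  simp only [g, Finset.prod_range_succ, Nat.factorial_succ, pow_succ]
  push_cast
  field_simp
  ring

lemma g_two (α : ℝ) : g α 2 = α * (α - 1) / 2 := by
  have h := succ_mul_g_succ α 1
  rw [g_one] at h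
  norm_num at h
  linarith

lemma neg_mul_sum_range_g (α : ℝ) (n : ℕ) :
    -α * ∑ k ∈ Finset.range (n + 1), g α k = ((n : ℝ) + 1) * g α (n + 1) := by
  induction n with
  | zero => simp [g_zero, g_one]
  | succ n ih =>
    have h := succ_mul_g_succ α (n + 1)
    rw [Finset.sum_range_succ, mul_add, ih]
    push_cast at h ⊢
    linarith

lemma g_add_two_nonneg {α : ℝ} (hα1 : 1 ≤ α) (hα2 : α ≤ 2) (n : ℕ) : 0 ≤ g α (n + 2) := by
  induction n with
  | zero => rw [zero_add, g_two]; nlinarith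
  | succ n ih =>
    have h := succ_mul_g_succ α (n + 2)
    push_cast at h
    have hn : (0 : ℝ) ≤ n := n.cast_nonneg
    have h' : 0 ≤ ((n : ℝ) + 2 - α) * g α (n + 2) := mul_nonneg (by linarith) ih
    rw [← h] at h'
    exact nonneg_of_mul_nonneg_right h' (by positivity)

lemma mul_g_add_two_le {α : ℝ} (hα1 : 1 ≤ α) (hα2 : α ≤ 2) (n : ℕ) :
    ((n : ℝ) + 1) * (((n : ℝ) + 2) * g α (n + 2)) ≤ α * (α - 1) := by
  induction n with
  | zero => rw [zero_add, g_two]; norm_num; linarith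
  | succ n ih =>
    have h := succ_mul_g_succ α (n + 2)
    have hg := g_add_two_nonneg hα1 hα2 n
    have hn : (0 : ℝ) ≤ n := n.cast_nonneg
    push_cast at h ⊢
    have h3 : ((n : ℝ) + 1 + 2) * g α (n + 1 + 2) = (n + 2 - α) * g α (n + 2) := by
      rw [← h]; ring_nf
    rw [h3]
    nlinarith [mul_nonneg (mul_nonneg (by linarith : (0 : ℝ) ≤ n + 2) hg) (sub_nonneg.2 hα1)]

lemma hasSum_g_add_two {α : ℝ} (hα1 : 1 ≤ α) (hα2 : α ≤ 2) :
    HasSum (fun n ↦ g α (n + 2)) (α - 1) := by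
  have hα0 : α ≠ 0 := by positivity
  rw [hasSum_iff_tendsto_nat_of_nonneg (g_add_two_nonneg hα1 hα2)]
  have hlim : Filter.Tendsto (fun n : ℕ ↦ ((n : ℝ) + 2) * g α (n + 2)) Filter.atTop (nhds 0) := by
    have h := (tendsto_one_div_add_atTop_nhds_zero_nat (𝕜 := ℝ)).const_mul (α * (α - 1))
    rw [mul_zero] at h
    refine squeeze_zero (fun n ↦ mul_nonneg (by positivity) (g_add_two_nonneg hα1 hα2 n))
      (fun n ↦ ?_) h
    rw [mul_one_div, le_div_iff₀ (by positivity), mul_comm]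
    exact mul_g_add_two_le hα1 hα2 n
  have h := (hlim.div_const α).const_sub (α - 1)
  rw [zero_div, sub_zero] at h
  refine h.congr fun n ↦ ?_
  have hs := neg_mul_sum_range_g α (n + 1)
  rw [Finset.sum_range_succ', Finset.sum_range_succ', zero_add, g_zero, g_one] at hs
  push_cast at hs
  field_simp
  linarith

lemma hasSum_g_add_three {α : ℝ} (hα1 : 1 ≤ α) (hα2 : α ≤ 2) :
    HasSum (fun n ↦ g α (n + 3)) (α - 1 - g α 2) := by
  simpa using (hasSum_nat_add_iff' 1).2 (hasSum_g_add_two hα1 hα2)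

/-- (Theorem 3.4) For the diagonals `t_k` of the constant-coefficient Toeplitz
matrix `T_N = (1/Δx^α)(d₊ G_α + d₋ G_αᵀ)`, the generating function
`p(θ) = ∑_{k∈ℤ} t_k e^{ikθ}` is in the Wiener class; more precisely
`∑_{k=-∞}^{∞} |t_k| = 2α (d₊ + d₋)/Δx^α < ∞`. -/
theorem stmt12 (α : ℝ) (hα1 : 1 < α) (hα2 : α < 2)
    (dp dm : ℝ) (hdp : 0 ≤ dp) (hdm : 0 ≤ dm) (hd : dp + dm ≠ 0)
    (Δx : ℝ) (hΔx : 0 < Δx) (t : ℤ → ℝ)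
    (ht0 : t 0 = (dp + dm) * g α 1 / Δx ^ α)
    (ht1 : t 1 = (dp * g α 2 + dm * g α 0) / Δx ^ α)
    (htm1 : t (-1) = (dp * g α 0 + dm * g α 2) / Δx ^ α)
    (htp : ∀ k : ℤ, 2 ≤ k → t k = dp * g α (k + 1).toNat / Δx ^ α)
    (htm : ∀ k : ℤ, k ≤ -2 → t k = dm * g α (-k + 1).toNat / Δx ^ α) :
    HasSum (fun k : ℤ => |t k|) (2 * α * (dp + dm) / Δx ^ α) := by
  have hc : 0 < Δx ^ α := Real.rpow_pos_of_pos hΔx α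
  have hg2 : 0 ≤ g α 2 := g_add_two_nonneg hα1.le hα2.le 0
  have hg3 (n : ℕ) : 0 ≤ g α (n + 3) := g_add_two_nonneg hα1.le hα2.le (n + 1)
  have hsum := hasSum_g_add_three hα1.le hα2.le
  have a0 : |t 0| = (dp + dm) * α / Δx ^ α := by
    rw [ht0, g_one, mul_neg, neg_div, abs_neg, abs_of_nonneg (by positivity)]
  have a1 : |t 1| = (dp * g α 2 + dm) / Δx ^ α := by
    rw [ht1, g_zero, mul_one, abs_of_nonneg (by positivity)]
  have am1 : |t (-1)| = (dp + dm * g α 2) / Δx ^ α := by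
    rw [htm1, g_zero, mul_one, abs_of_nonneg (by positivity)]
  have ap (n : ℕ) : |t ((n + 2 : ℕ) : ℤ)| = dp / Δx ^ α * g α (n + 3) := by
    rw [htp _ (by omega), show (((n + 2 : ℕ) : ℤ) + 1).toNat = n + 3 by omega,
      abs_of_nonneg (div_nonneg (mul_nonneg hdp (hg3 n)) hc.le)]
    ring
  have am (n : ℕ) : |t (-(((n + 1 : ℕ) : ℤ) + 1))| = dm / Δx ^ α * g α (n + 3) := by
    rw [htm _ (by omega), show (-(-(((n + 1 : ℕ) : ℤ) + 1)) + 1).toNat = n + 3 by omega,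
      abs_of_nonneg (div_nonneg (mul_nonneg hdm (hg3 n)) hc.le)]
    ring
  have hp : HasSum (fun n : ℕ ↦ |t n|)
      (dp / Δx ^ α * (α - 1 - g α 2) + (|t 0| + |t 1|)) := by
    have h := (hasSum_nat_add_iff (f := fun n : ℕ ↦ |t n|) 2).1
      (by simpa only [ap] using hsum.mul_left (dp / Δx ^ α))
    simpa [Finset.sum_range_succ] using h
  have hm : HasSum (fun n : ℕ ↦ |t (-((n : ℤ) + 1))|)
      (dm / Δx ^ α * (α - 1 - g α 2) + |t (-1)|) := by
    have h := (hasSum_nat_add_iff (f := fun n : ℕ ↦ |t (-((n : ℤ) + 1))|) 1).1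
      (by simpa only [am] using hsum.mul_left (dm / Δx ^ α))
    simpa using h
  have h : HasSum (fun k : ℤ ↦ |t k|) _ := hp.of_nat_of_neg_add_one hm
  have heq : dp / Δx ^ α * (α - 1 - g α 2) + (|t 0| + |t 1|) +
      (dm / Δx ^ α * (α - 1 - g α 2) + |t (-1)|) = 2 * α * (dp + dm) / Δx ^ α := by
    rw [a0, a1, am1]
    ring
  rwa [heq] at h
end

section
/- (Invertibility of the Strang-type BCCB preconditioner) Let μ ≥ 1, 0 ≤ ν ≤ μ, and s ≥ μ be integers, let α_0,…,α_μ and β_0,…,β_μ be real numbers, and define ρ(z) = ∑_{j=0}^{μ} α_j z^j and σ(z) = ∑_{j=0}^{μ} β_j z^j. Let s(A) be the (s+1)×(s+1) circulant matrix whose first column c satisfies c_0 = α_ν, c_r = α_{ν−r} for 1 ≤ r ≤ ν, c_{s+1−r} = α_{ν+r} for 1 ≤ r ≤ μ−ν, and c_r = 0 otherwise; let s(B) be defined in the same way from β_0,…,β_μ. Let C be an N×N complex circulant matrix and h > 0, and set S^{(2)} = s(A) ⊗ I_N − h s(B) ⊗ C. If for every eigenvalue λ of C and every complex number z with z^{s+1}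 = 1 one has ρ(z) − hλ σ(z) ≠ 0, then S^{(2)} is invertible. -/
open Matrix Kronecker

/-- First column of the Strang-type circulant `s(A)` of order `s+1` built from
LMF coefficients `a_0, …, a_μ` with `ν` initial conditions:
`c_0 = a_ν`, `c_r = a_{ν−r}` for `1 ≤ r ≤ ν`, `c_{s+1−r} = a_{ν+r}` for
`1 ≤ r ≤ μ−ν`, and `c_r = 0` otherwise. -/
def strangCol (a : ℕ → ℝ) (μ ν s : ℕ) : Fin (s + 1) → ℝ := fun r =>
  if (r : ℕ) = 0 then a ν
  else if (r : ℕ) ≤ ν then a (ν - (r : ℕ))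
  else if s + 1 - (μ - ν) ≤ (r : ℕ) then a (ν + (s + 1 - (r : ℕ)))
  else 0

/-- The symbol of a circulant matrix is a left eigenvalue for the vector of powers of a
root of unity. -/
lemma sum_pow_mul_circulant {n : ℕ} (c : Fin (n + 1) → ℂ) {w : ℂ} (hw : w ^ (n + 1) = 1)
    (j : Fin (n + 1)) :
    ∑ i : Fin (n + 1), w ^ (i : ℕ) * circulant c i j
      = (∑ r : Fin (n + 1), c r * w ^ (r : ℕ)) * w ^ (j : ℕ) := by
  rw [Finset.sum_mul]
  refine (Fintype.sum_equiv (Equiv.addRight j) _ _ fun r => ?_).symm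
  have hpow : w ^ ((r + j : Fin (n + 1)) : ℕ) = w ^ (r : ℕ) * w ^ (j : ℕ) := by
    rw [Fin.val_add, ← pow_add, ← pow_eq_pow_mod _ hw]
  simp only [Equiv.coe_addRight, circulant_apply, add_sub_cancel_right, hpow]
  ring

/-- The discrete Fourier transform in the first index turns `circulant c ⊗ₖ M` into a scalar
multiple of `M`. -/
lemma sum_pow_mul_circulant_kronecker_mulVec {n : ℕ} {m : Type*} [Fintype m]
    (c : Fin (n + 1) → ℂ) (M : Matrix m m ℂ) (x : Fin (n + 1) × m → ℂ) {w : ℂ}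
    (hw : w ^ (n + 1) = 1) (k : m) :
    ∑ i : Fin (n + 1), w ^ (i : ℕ) * ((circulant c ⊗ₖ M) *ᵥ x) (i, k)
      = (∑ r : Fin (n + 1), c r * w ^ (r : ℕ)) *
        (M *ᵥ fun l => ∑ j : Fin (n + 1), w ^ (j : ℕ) * x (j, l)) k := by
  have hcol : ∀ j l, ∑ i : Fin (n + 1), w ^ (i : ℕ) * (circulant c i j * M k l * x (j, l))
      = (∑ r : Fin (n + 1), c r * w ^ (r : ℕ)) * (M k l * (w ^ (j : ℕ) * x (j, l))) := by
    intro j l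
    calc _ = (∑ i : Fin (n + 1), w ^ (i : ℕ) * circulant c i j) * (M k l * x (j, l)) := by
          rw [Finset.sum_mul]
          exact Finset.sum_congr rfl fun i _ => by ring
      _ = _ := by
          rw [sum_pow_mul_circulant c hw]
          ring
  simp only [mulVec, dotProduct, kroneckerMap_apply, Fintype.sum_prod_type, Finset.mul_sum]
  rw [Finset.sum_comm, Finset.sum_comm (s := (Finset.univ : Finset m))]
  refine Finset.sum_congr rfl fun j _ => ?_
  rw [Finset.sum_comm]
  exact Finset.sum_congr rfl fun l _ => hcol j l

/-- The symbol of the Strang-type circulant, in terms of the characteristic polynomial. -/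
lemma strangCol_symbol {μ ν s : ℕ} (hν : ν ≤ μ) (hs : μ ≤ s) (a : ℕ → ℝ) {w z : ℂ}
    (hwz : w * z = 1) (hz : z ^ (s + 1) = 1) :
    (∑ r : Fin (s + 1), (strangCol a μ ν s r : ℂ) * w ^ (r : ℕ)) * z ^ ν
      = ∑ j ∈ Finset.range (μ + 1), (a j : ℂ) * z ^ j := by
  let e : ℕ → Fin (s + 1) := fun j =>
    Fin.ofNat (s + 1) (if j ≤ ν then ν - j else s + 1 + ν - j)
  have he : ∀ j ≤ μ, (e j : ℕ) = if j ≤ ν then ν - j else s + 1 + ν - j := by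
    intro j hj
    refine Nat.mod_eq_of_lt ?_
    split_ifs <;> omega
  rw [Finset.sum_mul]
  refine (Finset.sum_of_injOn e ?_ (fun _ _ => Finset.mem_coe.2 (Finset.mem_univ _)) ?_ ?_).symm
  · intro i hi j hj hij
    simp only [Finset.coe_range, Set.mem_Iio] at hi hj
    have hval := congrArg Fin.val hij
    rw [he i (by omega), he j (by omega)] at hval
    split_ifs at hval <;> omega
  · intro r _ hr
    have hne : ∀ j ≤ μ, (e j : ℕ) ≠ r := fun j hj hjr =>
      hr ⟨j, by simpa [Nat.lt_succ_iff] using hj, Fin.ext hjr⟩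
    have hr' := r.isLt
    have hcol : strangCol a μ ν s r = 0 := by
      unfold strangCol
      split_ifs with h0 h1 h2
      · exact absurd (by rw [he ν hν]; simp [h0]) (hne ν hν)
      · refine absurd ?_ (hne (ν - r) (by omega))
        rw [he _ (by omega), if_pos (by omega)]
        omega
      · refine absurd ?_ (hne (ν + (s + 1 - r)) (by omega))
        rw [he _ (by omega), if_neg (by omega)]
        omega
      · rfl
    simp [hcol]
  · intro j hj
    have hj' : j ≤ μ := by simpa [Nat.lt_succ_iff] using hj
    have hcol : strangCol a μ ν s (e j) = a j := by
      unfold strangCol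
      rw [he j hj']
      split_ifs <;> first | omega | (congr 1; omega)
    have hzν : z ^ ν = z ^ ((e j : ℕ) + j) := by
      rw [he j hj']
      split_ifs
      · congr 1
        omega
      · rw [show s + 1 + ν - j + j = s + 1 + ν by omega, pow_add, hz, one_mul]
    rw [hcol, hzν, pow_add, mul_assoc, ← mul_assoc (w ^ _), ← mul_pow, hwz, one_pow, one_mul]

/-- (Invertibility of the Strang-type BCCB preconditioner
`S⁽²⁾ = s(A) ⊗ I_N − h s(B) ⊗ C` with `C` circulant): if `ρ(z) − hλσ(z) ≠ 0`
for every eigenvalue `λ` of `C` and every `(s+1)`-st root of unity `z`, then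
`S⁽²⁾` is invertible. -/
theorem stmt17 (μ ν s N : ℕ) (hμ : 1 ≤ μ) (hν : ν ≤ μ) (hs : μ ≤ s) (hN : 1 ≤ N)
    (a b : ℕ → ℝ) (v : Fin N → ℂ) (h : ℝ) (hh : 0 < h)
    (S2 : Matrix (Fin (s + 1) × Fin N) (Fin (s + 1) × Fin N) ℂ)
    (hS2 : S2 = (Matrix.circulant (strangCol a μ ν s)).map Complex.ofReal
            ⊗ₖ (1 : Matrix (Fin N) (Fin N) ℂ) -
          (h : ℂ) • ((Matrix.circulant (strangCol b μ ν s)).map Complex.ofReal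
            ⊗ₖ Matrix.circulant v))
    (hroot : ∀ lam ∈ spectrum ℂ (Matrix.circulant v), ∀ z : ℂ, z ^ (s + 1) = 1 →
      (∑ j ∈ Finset.range (μ + 1), (a j : ℂ) * z ^ j) -
        (h : ℂ) * lam * (∑ j ∈ Finset.range (μ + 1), (b j : ℂ) * z ^ j) ≠ 0) :
    IsUnit S2 := by
  have hN' : Nonempty (Fin N) := ⟨⟨0, hN⟩⟩
  obtain ⟨lam₀, hlam₀⟩ := spectrum.nonempty_of_isAlgClosed_of_finiteDimensional ℂ (circulant v)
  have hker : ∀ x, S2 *ᵥ x = 0 → x = 0 := by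
    intro x hx
    have hdft : ∀ w : ℂ, w ^ (s + 1) = 1 →
        (fun l => ∑ j : Fin (s + 1), w ^ (j : ℕ) * x (j, l)) = 0 := by
      intro w hw
      have hw0 : w ≠ 0 := by
        rintro rfl
        simp at hw
      have hwz : w * w⁻¹ = 1 := mul_inv_cancel₀ hw0
      have hz : w⁻¹ ^ (s + 1) = 1 := by rw [inv_pow, hw, inv_one]
      set y : Fin N → ℂ := fun l => ∑ j : Fin (s + 1), w ^ (j : ℕ) * x (j, l) with hy
      set ρ := ∑ j ∈ Finset.range (μ + 1), (a j : ℂ) * w⁻¹ ^ j with hρ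
      set σ := ∑ j ∈ Finset.range (μ + 1), (b j : ℂ) * w⁻¹ ^ j with hσ
      have hrel : ∀ k, ρ * y k = h * σ * (circulant v *ᵥ y) k := by
        intro k
        have hA := sum_pow_mul_circulant_kronecker_mulVec
          (fun r => (strangCol a μ ν s r : ℂ)) (1 : Matrix (Fin N) (Fin N) ℂ) x hw k
        have hB := sum_pow_mul_circulant_kronecker_mulVec
          (fun r => (strangCol b μ ν s r : ℂ)) (circulant v) x hw k
        rw [one_mulVec] at hA
        have hsum : ∑ i : Fin (s + 1), w ^ (i : ℕ) * (S2 *ᵥ x) (i, k) = 0 := by simp [hx]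
        simp only [hS2, sub_mulVec, smul_mulVec, Pi.sub_apply, Pi.smul_apply, smul_eq_mul,
          map_circulant, mul_sub, Finset.sum_sub_distrib, mul_left_comm _ (h : ℂ),
          ← Finset.mul_sum] at hsum
        rw [hA, hB] at hsum
        rw [hρ, hσ, ← strangCol_symbol hν hs a hwz hz, ← strangCol_symbol hν hs b hwz hz]
        linear_combination w⁻¹ ^ ν * hsum
      by_contra hy0
      by_cases hσ0 : σ = 0
      · have hρ0 : ρ ≠ 0 := by
          simpa only [← hρ, ← hσ, hσ0, mul_zero, sub_zero] using hroot lam₀ hlam₀ w⁻¹ hz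
        exact hy0 (funext fun k => by simpa [hσ0, hρ0] using hrel k)
      · have hh0 : (h : ℂ) ≠ 0 := Complex.ofReal_ne_zero.2 hh.ne'
        refine hroot (ρ / (h * σ)) ?_ w⁻¹ hz (by rw [← hρ, ← hσ]; field_simp; ring)
        rw [← spectrum_toLin', ← Module.End.hasEigenvalue_iff_mem_spectrum]
        refine Module.End.hasEigenvalue_of_hasEigenvector (x := y)
          ⟨Module.End.mem_eigenspace_iff.2 (funext fun k => ?_), hy0⟩
        rw [toLin'_apply, Pi.smul_apply, smul_eq_mul, div_mul_eq_mul_div, hrel k]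
        field_simp
    have hprim := Complex.isPrimitiveRoot_exp (s + 1) s.succ_ne_zero
    set ζ := Complex.exp (2 * Real.pi * Complex.I / (s + 1 : ℕ))
    ext ⟨i, k⟩
    refine congrFun (eq_zero_of_forall_index_sum_pow_mul_eq_zero
      (f := fun i : Fin (s + 1) => ζ ^ (i : ℕ)) (v := fun i => x (i, k))
      (fun p q hpq => Fin.ext (hprim.pow_inj p.isLt q.isLt hpq)) fun p => ?_) i
    refine congrFun (hdft (ζ ^ (p : ℕ)) ?_) k
    rw [← pow_mul, mul_comm, pow_mul, hprim.pow_eq_one, one_pow]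
  rw [← mulVec_injective_iff_isUnit]
  intro x y hxy
  exact sub_eq_zero.1 (hker _ (by rw [mulVec_sub]; exact sub_eq_zero.2 hxy))
end
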